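/- Let (γ,ν) : I → ℝ² × S¹ be a Legendre curve with curvature (ℓ,β), and take v = ν and w̄ = ν̄ (i.e. θ(t) = τ(t) = 0). Then (γ,ν) is a (ν,ν̄)-Bertrand Legendre curve if and only if there exists a nonzero constant λ realizing the mate; in this case the mate γ̄ = γ + λν is a parallel curve of (γ,ν). -/

import Mathlib

open Real

noncomputable section

/-- Euclidean dot product on the plane `ℝ × ℝ`. -/
def dot (a b : ℝ × ℝ) : ℝ := a.1 * b.1 + a.2 * b.2

/-- `J`, the anticlockwise rotation by `π/2` on the plane: `J(a₁,a₂) = (−a₂,a₁)`. -/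
def Jrot (a : ℝ × ℝ) : ℝ × ℝ := (-a.2, a.1)

/-- `λ ≢ 0` on `I`: the set `{t ∈ I | λ t ≠ 0}` is dense in `I`. -/
def NotIdentZero (I : Set ℝ) (lam : ℝ → ℝ) : Prop :=
  I ⊆ closure {t | t ∈ I ∧ lam t ≠ 0}

/-- The unit tangent `γ̇/|γ̇|` of a plane curve (Euclidean norm). -/
def utang (γ : ℝ → ℝ × ℝ) (s : ℝ) : ℝ × ℝ :=
  (Real.sqrt (dot (deriv γ s) (deriv γ s)))⁻¹ • deriv γ s

/-- A Legendre curve on `I`: smooth `(γ,ν)` with `ν` unit and `γ̇·ν = 0` on `I`. -/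
def IsLegendre (I : Set ℝ) (γ ν : ℝ → ℝ × ℝ) : Prop :=
  ContDiff ℝ (⊤ : ℕ∞) γ ∧ ContDiff ℝ (⊤ : ℕ∞) ν ∧ (∀ t ∈ I, dot (ν t) (ν t) = 1) ∧
  (∀ t ∈ I, dot (deriv γ t) (ν t) = 0)

/-- The first component `ℓ = ν̇·μ` of the Legendre curvature, with `μ = J∘ν`. -/
def legL (ν : ℝ → ℝ × ℝ) (t : ℝ) : ℝ := dot (deriv ν t) (Jrot (ν t))

/-- The second component `β = γ̇·μ` of the Legendre curvature, with `μ = J∘ν`. -/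
def legB (γ ν : ℝ → ℝ × ℝ) (t : ℝ) : ℝ := dot (deriv γ t) (Jrot (ν t))

theorem dot_comm (a b : ℝ × ℝ) : dot a b = dot b a := by
  simp only [dot]; ring

theorem HasDerivWithinAt.dot {f g : ℝ → ℝ × ℝ} {f' g' : ℝ × ℝ} {s : Set ℝ} {t : ℝ}
    (hf : HasDerivWithinAt f f' s t) (hg : HasDerivWithinAt g g' s t) :
    HasDerivWithinAt (fun x => _root_.dot (f x) (g x))
      (_root_.dot f' (g t) + _root_.dot (f t) g') s t := by
  have hf₁ : HasDerivWithinAt (fun x => (f x).1) f'.1 s t := by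
    simpa using hf.hasFDerivWithinAt.fst.hasDerivWithinAt
  have hf₂ : HasDerivWithinAt (fun x => (f x).2) f'.2 s t := by
    simpa using hf.hasFDerivWithinAt.snd.hasDerivWithinAt
  have hg₁ : HasDerivWithinAt (fun x => (g x).1) g'.1 s t := by
    simpa using hg.hasFDerivWithinAt.fst.hasDerivWithinAt
  have hg₂ : HasDerivWithinAt (fun x => (g x).2) g'.2 s t := by
    simpa using hg.hasFDerivWithinAt.snd.hasDerivWithinAt
  refine ((hf₁.mul hg₁).add (hf₂.mul hg₂)).congr_deriv ?_
  simp only [_root_.dot]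
  ring

/-- A differentiable plane curve that is a unit vector along a nontrivial interval is orthogonal
to its derivative there. -/
theorem dot_deriv_eq_zero_of_unit {I : Set ℝ} (hI : I.OrdConnected) (hn : I.Nontrivial)
    {ν : ℝ → ℝ × ℝ} (hν : Differentiable ℝ ν) (hu : ∀ t ∈ I, dot (ν t) (ν t) = 1)
    {t : ℝ} (ht : t ∈ I) : dot (ν t) (deriv ν t) = 0 := by
  have hd := (hν t).hasDerivAt.hasDerivWithinAt (s := I)
  have hU : UniqueDiffWithinAt ℝ I t :=
    uniqueDiffOn_convex hI.convex (hI.convex.nontrivial_iff_nonempty_interior.1 hn) t ht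
  have h := hU.eq_deriv I (hd.dot hd)
    ((hasDerivWithinAt_const t I (1 : ℝ)).congr hu (hu t ht))
  rw [dot_comm (deriv ν t)] at h
  linarith

/-- The distance function between two Legendre curves sharing their normal is constant. -/
theorem eq_of_legendre_common_normal {I : Set ℝ} (hI : I.OrdConnected)
    {γ ν γb νb : ℝ → ℝ × ℝ} {lam : ℝ → ℝ} (hL : IsLegendre I γ ν) (hLb : IsLegendre I γb νb)
    (hγ : ∀ t ∈ I, γb t = γ t + lam t • ν t) (hν : ∀ t ∈ I, ν t = νb t)
    {s t : ℝ} (hs : s ∈ I) (ht : t ∈ I) : lam s = lam t := by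
  rcases I.subsingleton_or_nontrivial with hsub | hn
  · rw [hsub hs ht]
  obtain ⟨hγd, hνd, hu, ho⟩ := hL
  obtain ⟨hγbd, -, -, hob⟩ := hLb
  have hlam : ∀ x ∈ I, lam x = dot (γb x - γ x) (ν x) := by
    intro x hx
    have h := hu x hx
    simp only [dot] at h
    simp only [hγ x hx, dot, add_sub_cancel_left, Prod.smul_fst, Prod.smul_snd, smul_eq_mul]
    linear_combination -lam x * h
  have hderiv : ∀ x ∈ I, HasDerivWithinAt lam 0 I x := by
    intro x hx
    have hd := ((hγbd.differentiable (by simp) x).hasDerivAt.sub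
      (hγd.differentiable (by simp) x).hasDerivAt).hasDerivWithinAt (s := I)
    have h := (hd.dot (hνd.differentiable (by simp) x).hasDerivAt.hasDerivWithinAt).congr
      hlam (hlam x hx)
    refine h.congr_deriv ?_
    have h₁ := ho x hx
    have h₂ := hob x hx
    have h₃ := dot_deriv_eq_zero_of_unit hI hn (hνd.differentiable (by simp)) hu hx
    rw [← hν x hx] at h₂
    simp only [dot] at h₁ h₂ h₃
    simp only [Pi.sub_apply, hγ x hx, dot, add_sub_cancel_left, Prod.smul_fst, Prod.smul_snd,
      smul_eq_mul, Prod.fst_sub, Prod.snd_sub]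
    linear_combination h₂ - h₁ + lam x * h₃
  have h := hI.convex.norm_image_sub_le_of_norm_hasDerivWithin_le hderiv
    (fun x _ => norm_zero.le) ht hs
  rw [zero_mul, norm_le_zero_iff] at h
  exact sub_eq_zero.1 h

/-- **Corollary 4.7 (1).** A Legendre curve `(γ,ν)` is a `(ν,ν̄)`-Bertrand Legendre curve
iff there exists a nonzero constant `λ` realizing the mate; the mate `γ̄ = γ + λν` is
then a parallel curve of `(γ,ν)`. -/
theorem bertrand_nu_nubar_iff_parallel
    (I : Set ℝ) (hI : I.OrdConnected)
    (γ ν : ℝ → ℝ × ℝ) (hL : IsLegendre I γ ν) :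
    (∃ (γb νb : ℝ → ℝ × ℝ) (lam : ℝ → ℝ),
        IsLegendre I γb νb ∧ ContDiff ℝ (⊤ : ℕ∞) lam ∧ NotIdentZero I lam ∧
        (∀ t ∈ I, γb t = γ t + lam t • ν t) ∧
        (∀ t ∈ I, ν t = νb t)) ↔
    (∃ (γb νb : ℝ → ℝ × ℝ) (c : ℝ), c ≠ 0 ∧
        IsLegendre I γb νb ∧
        (∀ t ∈ I, γb t = γ t + c • ν t) ∧
        (∀ t ∈ I, ν t = νb t)) := by
  constructor
  · rintro ⟨γb, νb, lam, hLb, -, hne, hγ, hν⟩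
    rcases I.eq_empty_or_nonempty with rfl | ⟨t, ht⟩
    · exact ⟨γb, νb, 1, one_ne_zero, hLb, by simp, hν⟩
    · obtain ⟨s, hs, hs0⟩ := closure_nonempty_iff.1 ⟨t, hne ht⟩
      refine ⟨γb, νb, lam s, hs0, hLb, fun x hx => ?_, hν⟩
      rw [eq_of_legendre_common_normal hI hL hLb hγ hν hs hx, hγ x hx]
  · rintro ⟨γb, νb, c, hc, hLb, hγ, hν⟩
    exact ⟨γb, νb, fun _ => c, hLb, contDiff_const, fun t ht => subset_closure ⟨ht, hc⟩, hγ, hν⟩
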